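/- There is c* > 0 such that for every ε ∈ (0,1] and every σ ∈ (0, c*] there is C > 0 such that for every c > 0 there is n₀ ∈ ℕ with the following property for all n ≥ n₀. Let λ and d satisfy (log n)^{−3} ≤ λ ≤ c*, 10³·d ≤ λ·n, d ≥ C·log n and dn even; let m be an integer with ε·d·n ≤ m ≤ n^{1+σ}; set δ = 2m/n and suppose λ·δ ≥ C·log n; set p = m·(binom(n,2) − dn/2)^{−1}. Let K ~ G_d(n), form E by including each element of [n]^(2)∖E(K) independently with probability p, and let F = K + E. Then with probability at least 1 − c·n^{−14} the following holds: for each U ⊆ [n] with |U| ≤ λn/(100·δ·log n), if there is some U' ⊆ [n] with |U'| ≤ 4|U|/d and U ⊆ U' ∪ N_K(U'), then |E_{≥2,F∖K}(U)| ≤ (λ/(2·log n))·δ·|U|. (Lemma 6.7.) -/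

import Mathlib

open scoped Classical ENNReal

noncomputable section

namespace Sandwich

variable {n : ℕ}

/-- The degree of the vertex `v` in the graph `G`. -/
def deg (G : SimpleGraph (Fin n)) (v : Fin n) : ℕ := Nat.card (G.neighborSet v)

/-- `G` is a `d`-regular graph. -/
def IsRegularGraph (G : SimpleGraph (Fin n)) (d : ℕ) : Prop := ∀ v, deg G v = d

/-- The number of edges of `G`. -/
def edgeCount (G : SimpleGraph (Fin n)) : ℕ := G.edgeSet.ncard

/-- The probability of the event `P` under the probability mass function `μ`. -/
def prEvent {α : Type*} (μ : PMF α) (P : α → Prop) : ℝ≥0∞ := ∑' a, if P a then μ a else 0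

/-- `μ` is the uniform distribution on the set `S`. -/
def IsUniformOn {α : Type*} (μ : PMF α) (S : Set α) : Prop :=
  ∀ a, μ a = if a ∈ S then (S.ncard : ℝ≥0∞)⁻¹ else 0

/-- `P` lists the `k+1` vertices of a `(G₁,G₂)`-alternating path of length `k`: the vertices
are distinct and consecutive vertices are joined by an edge of `G₁` (for steps of even index)
or of `G₂` (for steps of odd index). -/
def IsAltSeq (G₁ G₂ : SimpleGraph (Fin n)) (k : ℕ) (P : Fin (k + 1) → Fin n) : Prop :=
  Function.Injective P ∧
    ∀ i : Fin k, if (i : ℕ) % 2 = 0 then G₁.Adj (P i.castSucc) (P i.succ)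
      else G₂.Adj (P i.castSucc) (P i.succ)

/-- The number of `(G₁,G₂)`-alternating `x,y`-paths of length `k` with no internal vertex
in `Z`. -/
def altPathCount (G₁ G₂ : SimpleGraph (Fin n)) (k : ℕ) (x y : Fin n) (Z : Set (Fin n)) : ℕ :=
  Nat.card {P : Fin (k + 1) → Fin n // IsAltSeq G₁ G₂ k P ∧ P 0 = x ∧ P (Fin.last k) = y ∧
    ∀ i : Fin (k + 1), i ≠ 0 → i ≠ Fin.last k → P i ∉ Z}

/-- The number of `(G₁,G₂)`-alternating paths of length `k` starting at `x`. -/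
def altStartCount (G₁ G₂ : SimpleGraph (Fin n)) (k : ℕ) (x : Fin n) : ℕ :=
  Nat.card {P : Fin (k + 1) → Fin n // IsAltSeq G₁ G₂ k P ∧ P 0 = x}

/-- The external neighbourhood `N_G(U)` of a set of vertices `U`. -/
def nbhd (G : SimpleGraph (Fin n)) (U : Set (Fin n)) : Set (Fin n) :=
  {v | v ∉ U ∧ ∃ u ∈ U, G.Adj u v}

/-- `e_G(U)`, the number of edges of `G` with both endpoints in `U`. -/
def edgesWithin (G : SimpleGraph (Fin n)) (U : Set (Fin n)) : ℕ :=
  {e ∈ G.edgeSet | ∀ v ∈ e, v ∈ U}.ncard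

/-- `e_G(U,V) = |{(u,v) : u ∈ U, v ∈ V, uv ∈ E(G)}|`. -/
def edgesBetween (G : SimpleGraph (Fin n)) (U V : Set (Fin n)) : ℕ :=
  {p : Fin n × Fin n | p.1 ∈ U ∧ p.2 ∈ V ∧ G.Adj p.1 p.2}.ncard

/-- `|E_{≥2,G}(U)|`, the number of edges `xy ∈ E(G)` with `x ∈ U`, `y ∉ U` such that some
`x' ∈ U ∖ {x}` also satisfies `x'y ∈ E(G)`. -/
def E2count (G : SimpleGraph (Fin n)) (U : Set (Fin n)) : ℕ :=
  {e : Sym2 (Fin n) | e ∈ G.edgeSet ∧ ∃ x y, e = s(x, y) ∧ x ∈ U ∧ y ∉ U ∧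
    ∃ x' ∈ U, x' ≠ x ∧ G.Adj x' y}.ncard

/-- `Σ_{u ∈ N_{F∖K}(v)} Σ_{u' ∈ N_K(u)} d_{F∖K}(u')`. -/
def doubleDegSum (F K : SimpleGraph (Fin n)) (v : Fin n) : ℝ :=
  ∑ u : Fin n, if (F \ K).Adj v u then
    ∑ u' : Fin n, if K.Adj u u' then (deg (F \ K) u' : ℝ) else 0
  else 0

/-- `μ` is the law of the binomial random graph `G(n,p)`. -/
def IsGnp (μ : PMF (SimpleGraph (Fin n))) (p : ℝ) : Prop :=
  ∀ G, μ G = ENNReal.ofReal (p ^ edgeCount G * (1 - p) ^ (n.choose 2 - edgeCount G))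

/-- `μ` is the law of `G(n,p)`, where `p` is truncated to `[0,1]` (so that `G(n,p)` is the
empty graph for `p ≤ 0` and the complete graph for `p ≥ 1`). -/
def IsGnpLaw (μ : PMF (SimpleGraph (Fin n))) (p : ℝ) : Prop :=
  IsGnp μ (max 0 (min p 1))

/-- `μ` is the law of `K + E`, where `E` includes each pair not in `E(K)` independently with
probability `p`. -/
def IsAddGnp (μ : PMF (SimpleGraph (Fin n))) (K : SimpleGraph (Fin n)) (p : ℝ) : Prop :=
  ∀ F, μ F = if K ≤ F then
      ENNReal.ofReal (p ^ (edgeCount F - edgeCount K) * (1 - p) ^ (n.choose 2 - edgeCount F))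
    else 0

/-- `ν` is the joint law of `(K, F)` where `K ~ G_d(n)` is a uniformly random `d`-regular graph
and `F = K + E`, `E` including each pair not in `E(K)` independently with probability `p`. -/
def IsRegAddGnp (ν : PMF (SimpleGraph (Fin n) × SimpleGraph (Fin n))) (d : ℕ) (p : ℝ) : Prop :=
  ∀ w, ν w = if IsRegularGraph w.1 d ∧ w.1 ≤ w.2 then
      ({G : SimpleGraph (Fin n) | IsRegularGraph G d}.ncard : ℝ≥0∞)⁻¹ *
        ENNReal.ofReal (p ^ (edgeCount w.2 - edgeCount w.1) *
          (1 - p) ^ (n.choose 2 - edgeCount w.2))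
    else 0

/-- `ν` is the joint law of an independent pair `(K, F)` with `K ~ G_d(n)` and `F ~ G(n,q)`. -/
def IsRegIndepGnp (ν : PMF (SimpleGraph (Fin n) × SimpleGraph (Fin n))) (d : ℕ) (q : ℝ) :
    Prop :=
  ∀ w, ν w = (if IsRegularGraph w.1 d then
      ({G : SimpleGraph (Fin n) | IsRegularGraph G d}.ncard : ℝ≥0∞)⁻¹ else 0) *
      ENNReal.ofReal (q ^ edgeCount w.2 * (1 - q) ^ (n.choose 2 - edgeCount w.2))

open Finset in
theorem sum_weight_superset_le {α : Type*} (M A : Finset α) {p : ℝ} (hp0 : 0 ≤ p) :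
    ∑ S ∈ M.powerset, (if A ⊆ S then p ^ #S * (1 - p) ^ (#M - #S) else 0) ≤ p ^ #A := by
  by_cases hA : A ⊆ M
  · have h := Finset.prod_add (fun _ => p) (fun i => if i ∈ A then 0 else 1 - p) M
    have hL : ∏ i ∈ M, (p + if i ∈ A then 0 else 1 - p) = p ^ #A := by
      rw [Finset.prod_congr rfl (g := fun i => if i ∈ A then p else 1) (fun i _ => by split_ifs <;> simp),
        Finset.prod_ite_mem, Finset.inter_eq_right.2 hA, Finset.prod_const]
    rw [← hL, h]
    refine (Finset.sum_congr rfl fun S hS => ?_).le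
    rw [Finset.mem_powerset] at hS
    split_ifs with hAS
    · rw [Finset.prod_const, Finset.prod_congr rfl (g := fun _ => 1 - p), Finset.prod_const,
        Finset.card_sdiff_of_subset hS]
      intro i hi
      rw [if_neg fun h => (Finset.mem_sdiff.1 hi).2 (hAS h)]
    · obtain ⟨a, haA, haS⟩ := Finset.not_subset.1 hAS
      rw [Finset.prod_eq_zero (i := a) (Finset.mem_sdiff.2 ⟨hA haA, haS⟩) (by simp [haA]),
        mul_zero]
  · rw [Finset.sum_eq_zero]
    · positivity
    · intro S hS
      rw [if_neg fun h => hA (h.trans (Finset.mem_powerset.1 hS))]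

open Finset in
theorem sum_powerset_card_ne_one {α : Type*} (B : Finset α) (x : ℝ) :
    ∑ A ∈ B.powerset with #A ≠ 1, x ^ #A = (1 + x) ^ #B - x * #B := by
  have h := Finset.sum_pow_mul_eq_add_pow x 1 B
  have h1 : ∑ A ∈ B.powerset with #A = 1, x ^ #A = x * #B := by
    rw [← Finset.powersetCard_eq_filter, Finset.sum_congr rfl (g := fun _ => x)]
    · simp [mul_comm]
    · intro A hA
      simp [(Finset.mem_powersetCard.1 hA).2]
  have h2 := Finset.sum_filter_add_sum_filter_not B.powerset (fun A => #A = 1) (fun A => x ^ #A)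
  simp only [one_pow, mul_one] at h
  rw [add_comm 1 x, ← h, ← h2, h1]
  simp

theorem two_pow_le_three_pow_sub (k : ℕ) :
    (2 : ℝ) ^ (if 2 ≤ k then k else 0) ≤ 3 ^ k - 2 * k := by
  rcases k with _ | _ | k
  · norm_num
  · norm_num
  · rw [if_pos (by omega)]
    induction k with
    | zero => norm_num
    | succ k ih =>
      have h : (1 : ℝ) ≤ 2 ^ (k + 1 + 1) := one_le_pow₀ (by norm_num)
      rw [pow_succ 2, pow_succ 3]
      push_cast at ih ⊢
      have hk : (0 : ℝ) ≤ k := k.cast_nonneg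
      nlinarith

open Finset in
/-- The number of vertices of `U` joined to `y` through `S`, counted only if there are at least
two of them. -/
def multiCount {V ι α : Type*} (e : V → ι → α) (U : Finset V) (S : Finset α) (y : ι) : ℕ :=
  if 2 ≤ #{x ∈ U | e x y ∈ S} then #{x ∈ U | e x y ∈ S} else 0

open Finset in
theorem sum_weight_two_pow_multiCount_le {V ι α : Type*} [Fintype ι] (e : V → ι → α)
    (U : Finset V) (he : ∀ x x' y y', x ∈ U → x' ∈ U → e x y = e x' y' → x = x' ∧ y = y')
    (M : Finset α) {p : ℝ} (hp0 : 0 ≤ p) (hp1 : p ≤ 1) :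
    ∑ S ∈ M.powerset, p ^ #S * (1 - p) ^ (#M - #S) * (2 : ℝ) ^ (∑ y, multiCount e U S y) ≤
      ((1 + 2 * p) ^ #U - 2 * p * #U) ^ Fintype.card ι := by
  set t : Finset (Finset V) := {A ∈ U.powerset | #A ≠ 1} with ht
  set g : Finset α → ι → Finset V → ℝ :=
    fun S y A => if ∀ x ∈ A, e x y ∈ S then 2 ^ #A else 0 with hg
  have hpt : ∀ S y, (2 : ℝ) ^ multiCount e U S y ≤ ∑ A ∈ t, g S y A := by
    intro S y
    refine (two_pow_le_three_pow_sub _).trans ?_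
    have h := sum_powerset_card_ne_one {x ∈ U | e x y ∈ S} 2
    norm_num at h
    rw [← h, hg, ← Finset.sum_filter]
    refine (Finset.sum_congr ?_ fun _ _ => rfl).le
    ext A
    simp only [ht, mem_filter, mem_powerset, Finset.subset_iff]
    constructor
    · rintro ⟨h1, h2⟩
      exact ⟨⟨fun x hx => (h1 hx).1, h2⟩, fun x hx => (h1 hx).2⟩
    · rintro ⟨⟨h1, h2⟩, h3⟩
      exact ⟨fun x hx => ⟨h1 hx, h3 x hx⟩, h2⟩
  have hw : ∀ S : Finset α, 0 ≤ p ^ #S * (1 - p) ^ (#M - #S) := fun S =>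
    mul_nonneg (pow_nonneg hp0 _) (pow_nonneg (by linarith) _)
  calc _ ≤ ∑ S ∈ M.powerset, p ^ #S * (1 - p) ^ (#M - #S) *
        ∑ f ∈ Fintype.piFinset fun _ : ι => t, ∏ y, g S y (f y) := by
        refine Finset.sum_le_sum fun S _ => mul_le_mul_of_nonneg_left ?_ (hw S)
        rw [← Finset.prod_univ_sum, ← Finset.prod_pow_eq_pow_sum]
        exact Finset.prod_le_prod (fun _ _ => by positivity) fun y _ => hpt S y
    _ = ∑ f ∈ Fintype.piFinset fun _ : ι => t, ∑ S ∈ M.powerset,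
        p ^ #S * (1 - p) ^ (#M - #S) * ∏ y, g S y (f y) := by
        simp_rw [Finset.mul_sum]
        exact Finset.sum_comm
    _ ≤ ∑ f ∈ Fintype.piFinset fun _ : ι => t, ∏ y, (2 * p) ^ #(f y) := by
        refine Finset.sum_le_sum fun f hf => ?_
        have hfU : ∀ y, f y ⊆ U := fun y => by
          have := Fintype.mem_piFinset.1 hf y
          exact Finset.mem_powerset.1 (Finset.mem_filter.1 this).1
        set A : Finset α := Finset.univ.biUnion fun y => (f y).image fun x => e x y with hA
        have hcard : #A = ∑ y, #(f y) := by
          rw [hA, Finset.card_biUnion]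
          · refine Finset.sum_congr rfl fun y _ => Finset.card_image_of_injOn ?_
            intro x hx x' hx' h
            exact (he x x' y y (hfU y hx) (hfU y hx') h).1
          · intro y _ y' _ hne
            rw [Function.onFun, Finset.disjoint_left]
            intro a ha ha'
            obtain ⟨x, hx, rfl⟩ := Finset.mem_image.1 ha
            obtain ⟨x', hx', h⟩ := Finset.mem_image.1 ha'
            exact hne (he x' x y' y (hfU y' hx') (hfU y hx) h).2.symm
        have hind : ∀ S, ∏ y, g S y (f y) = if A ⊆ S then ∏ y, (2 : ℝ) ^ #(f y) else 0 := by
          intro S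
          split_ifs with hAS
          · refine Finset.prod_congr rfl fun y _ => ?_
            rw [hg]
            refine if_pos fun x hx => hAS ?_
            exact Finset.mem_biUnion.2 ⟨y, Finset.mem_univ y, Finset.mem_image_of_mem _ hx⟩
          · obtain ⟨a, haA, haS⟩ := Finset.not_subset.1 hAS
            obtain ⟨y, -, hy⟩ := Finset.mem_biUnion.1 haA
            obtain ⟨x, hx, rfl⟩ := Finset.mem_image.1 hy
            exact Finset.prod_eq_zero (Finset.mem_univ y) (if_neg fun h => haS (h x hx))
        have hsum := sum_weight_superset_le M A hp0
        calc _ = (∑ S ∈ M.powerset, (if A ⊆ S then p ^ #S * (1 - p) ^ (#M - #S) else 0)) *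
              ∏ y, (2 : ℝ) ^ #(f y) := by
              rw [Finset.sum_mul]
              refine Finset.sum_congr rfl fun S _ => ?_
              rw [hind]
              split_ifs <;> simp
          _ ≤ p ^ #A * ∏ y, (2 : ℝ) ^ #(f y) :=
              mul_le_mul_of_nonneg_right hsum (by positivity)
          _ = _ := by
              rw [hcard, ← Finset.prod_pow_eq_pow_sum, ← Finset.prod_mul_distrib]
              refine Finset.prod_congr rfl fun y _ => ?_
              rw [mul_pow, mul_comm]
    _ = _ := by
        rw [← Finset.prod_univ_sum (fun _ => t) (fun _ A => (2 * p) ^ #A), Finset.prod_const,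
          Finset.card_univ, ht,
          sum_powerset_card_ne_one]

open Finset in
theorem sum_weight_multiCount_gt_le {V ι α : Type*} [Fintype ι] (e : V → ι → α)
    (U : Finset V) (he : ∀ x x' y y', x ∈ U → x' ∈ U → e x y = e x' y' → x = x' ∧ y = y')
    (M : Finset α) {p T : ℝ} (hp0 : 0 ≤ p) (hp1 : p ≤ 1) (hU : 2 * p * #U ≤ 1) :
    ∑ S ∈ M.powerset with T < ∑ y, (multiCount e U S y : ℝ), p ^ #S * (1 - p) ^ (#M - #S) ≤
      Real.exp (Fintype.card ι * (2 * p * #U) ^ 2 - Real.log 2 * T) := by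
  have hw : ∀ S : Finset α, 0 ≤ p ^ #S * (1 - p) ^ (#M - #S) := fun S =>
    mul_nonneg (pow_nonneg hp0 _) (pow_nonneg (by linarith) _)
  have hbase : (1 + 2 * p) ^ #U - 2 * p * #U ≤ Real.exp ((2 * p * #U) ^ 2) := by
    have h1 : (1 + 2 * p) ^ #U ≤ Real.exp (2 * p * #U) := by
      rw [mul_comm (2 * p), Real.exp_nat_mul]
      exact pow_le_pow_left₀ (by positivity) (by linarith [Real.add_one_le_exp (2 * p)]) _
    have h2 := Real.abs_exp_sub_one_sub_id_le
      (x := 2 * p * #U) (by rwa [abs_of_nonneg (by positivity)])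
    have h3 := (abs_le.1 h2).2
    have h4 := Real.add_one_le_exp ((2 * p * #U) ^ 2)
    linarith
  have hbase0 : 0 ≤ (1 + 2 * p) ^ #U - 2 * p * #U := by
    have := one_add_mul_le_pow (a := 2 * p) (by linarith) #U
    linarith
  have hmom := (sum_weight_two_pow_multiCount_le e U he M hp0 hp1).trans
    (pow_le_pow_left₀ hbase0 hbase _)
  rw [← Real.exp_nat_mul] at hmom
  rw [Real.exp_sub, le_div_iff₀ (Real.exp_pos _), Finset.sum_mul]
  refine le_trans ?_ hmom
  refine (Finset.sum_le_sum fun S hS => ?_).trans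
    (Finset.sum_le_sum_of_subset_of_nonneg (Finset.filter_subset _ _)
      fun S _ _ => mul_nonneg (hw S) (by positivity))
  refine mul_le_mul_of_nonneg_left ?_ (hw S)
  have hT := (Finset.mem_filter.1 hS).2.le
  rw [← Real.rpow_natCast, Real.rpow_def_of_pos two_pos, Real.exp_le_exp]
  push_cast
  exact mul_le_mul_of_nonneg_left hT (Real.log_nonneg one_le_two)

open Finset in
theorem E2count_le_sum_multiCount (G : SimpleGraph (Fin n)) [Fintype G.edgeSet] (U : Set (Fin n)) :
    E2count G U ≤
      ∑ y : {y // y ∉ U}, multiCount (fun x (y : {y // y ∉ U}) => s(x, (y : Fin n)))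
        U.toFinset G.edgeFinset y := by
  set N : {y // y ∉ U} → Finset (Fin n) := fun y => {x ∈ U.toFinset | s(x, y.1) ∈ G.edgeFinset}
    with hN
  set A : Finset (Sym2 (Fin n)) := Finset.univ.biUnion fun y : {y // y ∉ U} =>
    (if 2 ≤ #(N y) then N y else ∅).image fun x => s(x, y.1) with hA
  have hsub : {e : Sym2 (Fin n) | e ∈ G.edgeSet ∧ ∃ x y, e = s(x, y) ∧ x ∈ U ∧ y ∉ U ∧
      ∃ x' ∈ U, x' ≠ x ∧ G.Adj x' y} ⊆ (A : Set (Sym2 (Fin n))) := by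
    rintro e ⟨he, x, y, rfl, hx, hy, x', hx', hne, hadj⟩
    have h1 : x ∈ N ⟨y, hy⟩ := by simpa [hN, hx] using he
    have h2 : x' ∈ N ⟨y, hy⟩ := by simpa [hN, hx'] using hadj
    have h3 : 2 ≤ #(N ⟨y, hy⟩) := Finset.one_lt_card.2 ⟨x', h2, x, h1, hne⟩
    rw [Finset.mem_coe, hA, Finset.mem_biUnion]
    refine ⟨⟨y, hy⟩, Finset.mem_univ _, ?_⟩
    rw [if_pos h3]
    exact Finset.mem_image_of_mem _ h1
  refine (Set.ncard_le_ncard hsub (Finset.finite_toSet _)).trans ?_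
  rw [Set.ncard_coe_finset]
  refine Finset.card_biUnion_le.trans (Finset.sum_le_sum fun y _ => ?_)
  refine Finset.card_image_le.trans ?_
  unfold multiCount
  split_ifs <;> simp_all

open Finset in
theorem sum_weight_E2count_gt_le (K : SimpleGraph (Fin n)) (U : Set (Fin n)) {p T : ℝ}
    (hp0 : 0 ≤ p) (hp1 : p ≤ 1) (hU : 2 * p * U.ncard ≤ 1) :
    ∑ F : SimpleGraph (Fin n) with K ≤ F ∧ T < E2count (F \ K) U,
      p ^ (edgeCount F - edgeCount K) * (1 - p) ^ (n.choose 2 - edgeCount F) ≤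
      Real.exp (n * (2 * p * U.ncard) ^ 2 - Real.log 2 * T) := by
  rw [Set.ncard_eq_toFinset_card'] at hU ⊢
  have he : ∀ (x x' : Fin n) (y y' : {y // y ∉ U}), x ∈ U.toFinset → x' ∈ U.toFinset →
      s(x, (y : Fin n)) = s(x', (y' : Fin n)) → x = x' ∧ y = y' := by
    rintro x x' ⟨y, hy⟩ ⟨y', hy'⟩ hx hx' h
    rw [Set.mem_toFinset] at hx hx'
    rcases Sym2.eq_iff.1 h with ⟨h1, h2⟩ | ⟨h1, h2⟩
    · exact ⟨h1, Subtype.ext h2⟩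
    · exact absurd hx (h1.symm ▸ hy')
  have hcount : ∀ G : SimpleGraph (Fin n), edgeCount G = #G.edgeFinset := fun G => by
    rw [edgeCount, ← SimpleGraph.coe_edgeFinset, Set.ncard_coe_finset]
  have htail := sum_weight_multiCount_gt_le (fun x (y : {y // y ∉ U}) => s(x, (y : Fin n)))
    U.toFinset he Kᶜ.edgeFinset (T := T) hp0 hp1 hU
  have hM : #(Kᶜ).edgeFinset = n.choose 2 - #K.edgeFinset := by
    have h := SimpleGraph.card_edgeFinset_top_eq_card_choose_two (V := Fin n)
    rw [Fintype.card_fin] at h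
    rw [← h, ← Finset.card_sdiff_of_subset (SimpleGraph.edgeFinset_mono le_top),
      ← SimpleGraph.edgeFinset_sdiff]
    congr 1
    rw [SimpleGraph.edgeFinset_inj, top_sdiff]
  have hcard : ∀ F, K ≤ F → #(F \ K).edgeFinset = #F.edgeFinset - #K.edgeFinset := by
    intro F hF
    rw [SimpleGraph.edgeFinset_sdiff, Finset.card_sdiff_of_subset (SimpleGraph.edgeFinset_mono hF)]
  have hinj : Set.InjOn (fun F : SimpleGraph (Fin n) => (F \ K).edgeFinset)
      (({F | K ≤ F ∧ T < E2count (F \ K) U} : Finset (SimpleGraph (Fin n))) : Set _) := by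
    intro F hF F' hF' h
    rw [Finset.mem_coe, Finset.mem_filter] at hF hF'
    have h1 : F \ K = F' \ K := SimpleGraph.edgeFinset_inj.1 h
    rw [← sdiff_sup_cancel hF.2.1, h1, sdiff_sup_cancel hF'.2.1]
  have hle : (Fintype.card {y // y ∉ U} : ℝ) ≤ n := by
    have := Fintype.card_subtype_le fun y => y ∉ U
    rw [Fintype.card_fin] at this
    exact_mod_cast this
  calc _ = ∑ F : SimpleGraph (Fin n) with K ≤ F ∧ T < E2count (F \ K) U,
        p ^ #(F \ K).edgeFinset * (1 - p) ^ (#(Kᶜ).edgeFinset - #(F \ K).edgeFinset) := by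
        refine Finset.sum_congr rfl fun F hF => ?_
        have hKF := (Finset.mem_filter.1 hF).2.1
        have := Finset.card_le_card (SimpleGraph.edgeFinset_mono hKF)
        rw [hcard F hKF, hM, hcount, hcount]
        congr 2
        omega
    _ = ∑ S ∈ image (fun F : SimpleGraph (Fin n) => (F \ K).edgeFinset)
        {F | K ≤ F ∧ T < E2count (F \ K) U}, p ^ #S * (1 - p) ^ (#(Kᶜ).edgeFinset - #S) := by
        rw [Finset.sum_image hinj]
    _ ≤ _ := by
        refine Finset.sum_le_sum_of_subset_of_nonneg ?_ fun S _ _ =>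
          mul_nonneg (pow_nonneg hp0 _) (pow_nonneg (by linarith) _)
        intro S hS
        obtain ⟨F, hF, rfl⟩ := Finset.mem_image.1 hS
        have hF := (Finset.mem_filter.1 hF).2
        refine Finset.mem_filter.2 ⟨Finset.mem_powerset.2 (SimpleGraph.edgeFinset_mono ?_), ?_⟩
        · rw [sdiff_eq]
          exact inf_le_right
        · refine hF.2.trans_le ?_
          exact_mod_cast E2count_le_sum_multiCount (F \ K) U
    _ ≤ _ := htail
    _ ≤ _ := Real.exp_le_exp.2 (by gcongr)

/-- `U'` dominates `U` in `K` and has size at most `4|U|/d`. -/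
def IsCover (K : SimpleGraph (Fin n)) (d : ℕ) (U U' : Set (Fin n)) : Prop :=
  (U'.ncard : ℝ) ≤ 4 * U.ncard / d ∧ U ⊆ U' ∪ nbhd K U'

theorem ncard_union_nbhd_le {K : SimpleGraph (Fin n)} {d : ℕ} (hK : IsRegularGraph K d)
    (U' : Set (Fin n)) : (U' ∪ nbhd K U').ncard ≤ (d + 1) * U'.ncard := by
  have hN : (nbhd K U').ncard ≤ d * U'.ncard := by
    have hsub : nbhd K U' ⊆
        ((U'.toFinset.biUnion fun u => (K.neighborSet u).toFinset : Finset _) : Set (Fin n)) := by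
      rintro v ⟨-, u, hu, huv⟩
      simp only [Finset.coe_biUnion, Set.mem_iUnion]
      exact ⟨u, by simpa using hu, by simpa using huv⟩
    refine (Set.ncard_le_ncard hsub (Finset.finite_toSet _)).trans ?_
    rw [Set.ncard_coe_finset, Set.ncard_eq_toFinset_card', mul_comm]
    refine Finset.card_biUnion_le_card_mul _ _ _ fun u _ => ?_
    rw [← hK u, deg, Nat.card_eq_card_toFinset]
  have := Set.ncard_union_le U' (nbhd K U')
  rw [add_mul, one_mul]
  omega

theorem sum_covered_exp_le {K : SimpleGraph (Fin n)} {d : ℕ} (hK : IsRegularGraph K d)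
    (hd : 1 ≤ d) (hn : n * Real.exp (-d) ≤ 1) :
    ∑ U : Set (Fin n) with U.Nonempty ∧ ∃ U', IsCover K d U U', Real.exp (-15 * U.ncard) ≤
      3 * Real.exp (-d) := by
  have hd' : (1 : ℝ) ≤ d := by exact_mod_cast hd
  have hinner : ∀ U' : Set (Fin n),
      ∑ U : Set (Fin n) with U.Nonempty ∧ IsCover K d U U', Real.exp (-15 * U.ncard) ≤
        Real.exp (-d) * Real.exp (-d) ^ U'.ncard := by
    intro U'
    rcases U'.eq_empty_or_nonempty with rfl | hne
    · rw [Finset.filter_eq_empty_iff.2]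
      · rw [Finset.sum_empty]
        positivity
      · rintro U - ⟨⟨x, hx⟩, -, hU⟩
        simpa [nbhd] using hU hx
    · have hs : (1 : ℝ) ≤ U'.ncard := by
        exact_mod_cast (Set.ncard_pos (Set.toFinite _)).2 hne
      have hterm : ∀ U ∈ ({U | U.Nonempty ∧ IsCover K d U U'} : Finset (Set (Fin n))),
          Real.exp (-15 * U.ncard) ≤ Real.exp (-(15 / 4) * (d * U'.ncard)) := by
        intro U hU
        have h := (Finset.mem_filter.1 hU).2.2.1
        rw [le_div_iff₀ (by linarith)] at h
        rw [Real.exp_le_exp]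
        linarith
      have hcount : ((({U | U.Nonempty ∧ IsCover K d U U'} : Finset (Set (Fin n))).card : ℕ) : ℝ)
          ≤ Real.exp (Real.log 2 * (2 * (d * U'.ncard))) := by
        have h1 : ({U | U.Nonempty ∧ IsCover K d U U'} : Finset (Set (Fin n))).card ≤
            2 ^ (U' ∪ nbhd K U').ncard := by
          rw [← Set.ncard_powerset, ← Set.ncard_coe_finset]
          refine Set.ncard_le_ncard (fun U hU => ?_) (Set.toFinite _)
          rw [Finset.mem_coe, Finset.mem_filter] at hU
          exact hU.2.2.2
        have h2 : (U' ∪ nbhd K U').ncard ≤ 2 * (d * U'.ncard) := by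
          refine (ncard_union_nbhd_le hK U').trans ?_
          rw [← mul_assoc]
          exact Nat.mul_le_mul_right _ (by omega)
        have h3 : ((2 : ℝ) ^ (2 * (d * U'.ncard))) = Real.exp (Real.log 2 * (2 * (d * U'.ncard))) := by
          rw [← Real.rpow_natCast, Real.rpow_def_of_pos two_pos]
          push_cast
          rfl
        rw [← h3]
        exact_mod_cast h1.trans (Nat.pow_le_pow_right two_pos h2)
      refine (Finset.sum_le_card_nsmul _ _ _ hterm).trans ?_
      rw [nsmul_eq_mul]
      refine (mul_le_mul_of_nonneg_right hcount (Real.exp_pos _).le).trans ?_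
      rw [← Real.exp_add, ← Real.exp_nat_mul, ← Real.exp_add, Real.exp_le_exp]
      have hlog := Real.log_two_lt_d9
      have hds : (d : ℝ) ≤ d * U'.ncard := le_mul_of_one_le_right (by linarith) hs
      nlinarith
  have hsum : ∑ U' : Set (Fin n), Real.exp (-d) ^ U'.ncard ≤ 3 := by
    have h := Fintype.sum_pow_mul_eq_add_pow (Fin n) (Real.exp (-d)) 1
    simp only [one_pow, mul_one, Fintype.card_fin] at h
    have h1 : ∑ U' : Set (Fin n), Real.exp (-d) ^ U'.ncard = (Real.exp (-d) + 1) ^ n := by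
      rw [← h]
      refine Fintype.sum_equiv Fintype.finsetEquivSet.symm _ _ fun U => ?_
      rw [Fintype.finsetEquivSet_symm_apply, Set.ncard_eq_toFinset_card']
    rw [h1]
    calc _ ≤ Real.exp (Real.exp (-d)) ^ n :=
          pow_le_pow_left₀ (by positivity) (Real.add_one_le_exp _) _
      _ = Real.exp (n * Real.exp (-d)) := (Real.exp_nat_mul _ _).symm
      _ ≤ Real.exp 1 := Real.exp_le_exp.2 hn
      _ ≤ 3 := by linarith [Real.exp_one_lt_d9]
  calc _ ≤ ∑ U' : Set (Fin n),
        ∑ U : Set (Fin n) with U.Nonempty ∧ IsCover K d U U', Real.exp (-15 * U.ncard) := by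
        simp_rw [Finset.sum_filter]
        rw [Finset.sum_comm]
        refine Finset.sum_le_sum fun U _ => ?_
        split_ifs with h
        · obtain ⟨hU, U', hU'⟩ := h
          refine le_trans (by rw [if_pos ⟨hU, hU'⟩]) (Finset.single_le_sum
            (f := fun U' => if U.Nonempty ∧ IsCover K d U U' then Real.exp (-15 * U.ncard) else 0)
            (fun _ _ => by split_ifs <;> positivity) (Finset.mem_univ U'))
        · exact Finset.sum_nonneg fun _ _ => by split_ifs <;> positivity
    _ ≤ ∑ U' : Set (Fin n), Real.exp (-d) * Real.exp (-d) ^ U'.ncard :=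
        Finset.sum_le_sum fun U' _ => hinner U'
    _ ≤ _ := by
        rw [← Finset.mul_sum, mul_comm]
        exact mul_le_mul_of_nonneg_right hsum (Real.exp_pos _).le

/-- Some set of at most `L` vertices is covered in the sense of `IsCover` and has more than
`t|U|` edges counted by `E2count`. -/
def HasBadSet (K F : SimpleGraph (Fin n)) (d : ℕ) (L t : ℝ) : Prop :=
  ∃ U : Set (Fin n), (U.ncard : ℝ) ≤ L ∧ (∃ U', IsCover K d U U') ∧
    t * U.ncard < E2count (F \ K) U

theorem sum_weight_hasBadSet_le {K : SimpleGraph (Fin n)} {d : ℕ} (hK : IsRegularGraph K d)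
    (hd : 1 ≤ d) (hn : n * Real.exp (-d) ≤ 1) {p L t : ℝ} (hp0 : 0 ≤ p) (hp1 : p ≤ 1)
    (hL : 2 * p * L ≤ 1)
    (ht : ∀ u : ℝ, 0 ≤ u → u ≤ L → n * (2 * p * u) ^ 2 - Real.log 2 * (t * u) ≤ -15 * u) :
    ∑ F : SimpleGraph (Fin n) with K ≤ F ∧ HasBadSet K F d L t,
      p ^ (edgeCount F - edgeCount K) * (1 - p) ^ (n.choose 2 - edgeCount F) ≤
      3 * Real.exp (-d) := by
  set w : SimpleGraph (Fin n) → ℝ := fun F =>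
    p ^ (edgeCount F - edgeCount K) * (1 - p) ^ (n.choose 2 - edgeCount F) with hw
  have hw0 : ∀ F, 0 ≤ w F := fun F =>
    mul_nonneg (pow_nonneg hp0 _) (pow_nonneg (by linarith) _)
  set 𝒰 : Finset (Set (Fin n)) := {U | U.Nonempty ∧ ∃ U', IsCover K d U U'} with h𝒰
  calc ∑ F : SimpleGraph (Fin n) with K ≤ F ∧ HasBadSet K F d L t, w F
      ≤ ∑ U ∈ 𝒰 with (U.ncard : ℝ) ≤ L,
        ∑ F : SimpleGraph (Fin n) with K ≤ F ∧ t * U.ncard < E2count (F \ K) U, w F := by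
        simp_rw [Finset.sum_filter (s := (Finset.univ : Finset (SimpleGraph (Fin n))))]
        rw [Finset.sum_comm]
        refine Finset.sum_le_sum fun F _ => ?_
        have hnn : ∀ U : Set (Fin n), 0 ≤
            if K ≤ F ∧ t * U.ncard < E2count (F \ K) U then w F else 0 := fun U => by
          split_ifs
          exacts [hw0 F, le_rfl]
        split_ifs with h
        · obtain ⟨hKF, U, hUL, hU', hE⟩ := h
          have hne : U.Nonempty := by
            rw [Set.nonempty_iff_ne_empty]
            rintro rfl
            simp [E2count] at hE
          refine le_trans (by rw [if_pos ⟨hKF, hE⟩]) (Finset.single_le_sum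
            (f := fun U => if K ≤ F ∧ t * U.ncard < E2count (F \ K) U then w F else 0)
            (fun U _ => hnn U) (a := U) ?_)
          simp only [h𝒰, Finset.mem_filter, Finset.mem_univ, true_and]
          exact ⟨⟨hne, hU'⟩, hUL⟩
        · exact Finset.sum_nonneg fun U _ => hnn U
    _ ≤ ∑ U ∈ 𝒰 with (U.ncard : ℝ) ≤ L, Real.exp (-15 * U.ncard) := by
        refine Finset.sum_le_sum fun U hU => ?_
        have hUL := (Finset.mem_filter.1 hU).2
        refine (sum_weight_E2count_gt_le K U hp0 hp1 ?_).trans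
          (Real.exp_le_exp.2 (ht _ (Nat.cast_nonneg _) hUL))
        exact (mul_le_mul_of_nonneg_left hUL (by positivity)).trans hL
    _ ≤ ∑ U ∈ 𝒰, Real.exp (-15 * U.ncard) :=
        Finset.sum_le_sum_of_subset_of_nonneg (Finset.filter_subset _ _)
          fun _ _ _ => (Real.exp_pos _).le
    _ ≤ _ := sum_covered_exp_le hK hd hn

theorem prEvent_add_prEvent_not {α : Type*} (μ : PMF α) (P : α → Prop) :
    prEvent μ P + prEvent μ (fun a => ¬ P a) = 1 := by
  rw [prEvent, prEvent, ← ENNReal.tsum_add, ← μ.tsum_coe]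
  refine tsum_congr fun a => ?_
  by_cases h : P a <;> simp [h]

/-- For the law of `(K, F)`, an event that has conditional probability at most `B` given any
`d`-regular `K` has probability at most `B`. -/
theorem prEvent_le_of_forall_regular {ν : PMF (SimpleGraph (Fin n) × SimpleGraph (Fin n))}
    {d : ℕ} {p B : ℝ} (hν : IsRegAddGnp ν d p) (hp0 : 0 ≤ p) (hp1 : p ≤ 1)
    (P : SimpleGraph (Fin n) × SimpleGraph (Fin n) → Prop)
    (hP : ∀ K, IsRegularGraph K d → ∑ F : SimpleGraph (Fin n) with K ≤ F ∧ P (K, F),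
      p ^ (edgeCount F - edgeCount K) * (1 - p) ^ (n.choose 2 - edgeCount F) ≤ B) :
    prEvent ν P ≤ ENNReal.ofReal B := by
  set N : ℝ≥0∞ := ({G : SimpleGraph (Fin n) | IsRegularGraph G d}.ncard : ℝ≥0∞) with hN
  have hK : ∀ K, ∑ F, (if P (K, F) then ν (K, F) else 0) ≤
      if IsRegularGraph K d then N⁻¹ * ENNReal.ofReal B else 0 := by
    intro K
    split_ifs with hreg
    · refine le_trans ?_ (mul_le_mul_right (ENNReal.ofReal_le_ofReal (hP K hreg)) N⁻¹)
      rw [ENNReal.ofReal_sum_of_nonneg fun F _ =>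
        mul_nonneg (pow_nonneg hp0 _) (pow_nonneg (by linarith) _), Finset.mul_sum,
        Finset.sum_filter]
      refine Finset.sum_le_sum fun F _ => ?_
      rw [hν (K, F)]
      by_cases h1 : P (K, F) <;> by_cases h2 : K ≤ F <;> simp [h1, h2, hreg, hN]
    · refine (Finset.sum_eq_zero fun F _ => ?_).le
      rw [hν (K, F)]
      simp [hreg]
  rw [prEvent, tsum_fintype, Fintype.sum_prod_type]
  refine (Finset.sum_le_sum fun K _ => hK K).trans ?_
  rw [← Finset.sum_filter, Finset.sum_const, nsmul_eq_mul, ← mul_assoc]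
  have hcard : ((({K | IsRegularGraph K d} : Finset (SimpleGraph (Fin n))).card : ℕ) : ℝ≥0∞) = N := by
    rw [hN, Set.ncard_eq_toFinset_card', Set.toFinset_ofPred]
  rw [hcard]
  exact mul_le_of_le_one_left' (ENNReal.mul_inv_le_one N)

/-- **Lemma 6.7.** There is `c* > 0` such that for every `ε ∈ (0,1]` and every
`σ ∈ (0,c*]` there is `C > 0` such that for every `c > 0` and all sufficiently large `n`:
with `(log n)⁻³ ≤ λ ≤ c*`, `10³d ≤ λn`, `d ≥ C log n`, `dn` even, `ε d n ≤ m ≤ n^{1+σ}`,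
`δ = 2m/n` with `λδ ≥ C log n`, `p = m(binom(n,2) − dn/2)⁻¹`, and `(K,F)` with
`K ~ G_d(n)`, `F = K + E`, with probability at least `1 − c n⁻¹⁴`: for each `U` with
`|U| ≤ λn/(100 δ log n)`, if there is `U'` with `|U'| ≤ 4|U|/d` and `U ⊆ U' ∪ N_K(U')`,
then `|E_{≥2,F∖K}(U)| ≤ (λ/(2 log n))·δ|U|`. -/
theorem gnp_expansion_E2 :
    ∃ cstar : ℝ, 0 < cstar ∧
      ∀ ε : ℝ, 0 < ε → ε ≤ 1 →
        ∀ σ : ℝ, 0 < σ → σ ≤ cstar →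
          ∃ C : ℝ, 0 < C ∧
            ∀ c : ℝ, 0 < c →
              ∃ n₀ : ℕ, ∀ n : ℕ, n₀ ≤ n →
                ∀ lam : ℝ, ∀ d m : ℕ,
                  ((Real.log n) ^ 3)⁻¹ ≤ lam → lam ≤ cstar →
                  10 ^ 3 * (d : ℝ) ≤ lam * n → C * Real.log n ≤ (d : ℝ) → Even (d * n) →
                  ε * d * n ≤ (m : ℝ) → (m : ℝ) ≤ (n : ℝ) ^ ((1 : ℝ) + σ) →
                  ∀ δ p : ℝ, δ = 2 * (m : ℝ) / n → C * Real.log n ≤ lam * δ →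
                    p = (m : ℝ) / ((n.choose 2 : ℝ) - d * n / 2) →
                    ∀ ν : PMF (SimpleGraph (Fin n) × SimpleGraph (Fin n)),
                      IsRegAddGnp ν d p →
                      ENNReal.ofReal (1 - c / (n : ℝ) ^ 14) ≤
                        prEvent ν (fun w =>
                          ∀ U : Set (Fin n),
                            (U.ncard : ℝ) ≤ lam * n / (100 * δ * Real.log n) →
                            (∃ U' : Set (Fin n), (U'.ncard : ℝ) ≤ 4 * U.ncard / d ∧
                                U ⊆ U' ∪ nbhd w.1 U') →
                              (E2count (w.2 \ w.1) U : ℝ) ≤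
                                lam / (2 * Real.log n) * δ * U.ncard) := by
  refine ⟨1 / 2, by norm_num, fun ε _ _ σ _ hσ => ⟨100, by norm_num, fun c hc =>
    ⟨max 16 ⌈3 / c⌉₊, ?_⟩⟩⟩
  intro n hn lam d m hlam0 hlam1 hdn hd _ _ hm δ p hδ hδC hp ν hν
  have hn16 : (16 : ℝ) ≤ n := by exact_mod_cast (le_max_left _ _).trans hn
  have hnc : 3 / c ≤ n := (Nat.le_ceil _).trans (by exact_mod_cast (le_max_right _ _).trans hn)
  have hn0 : (0 : ℝ) < n := by linarith
  have hlog : 1 ≤ Real.log n := by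
    rw [Real.le_log_iff_exp_le hn0]
    linarith [Real.exp_one_lt_d9]
  have hlog0 : 0 < Real.log n := by linarith
  have hlam : 0 < lam := lt_of_lt_of_le (by positivity) hlam0
  have hδ0 : 0 < δ := pos_of_mul_pos_right (lt_of_lt_of_le (by positivity) hδC) hlam.le
  have hd1 : 1 ≤ d := by
    have : (1 : ℝ) ≤ d := by linarith
    exact_mod_cast this
  have hm0 : (m : ℝ) = δ * n / 2 := by rw [hδ]; field_simp
  have hden : (n : ℝ) ^ 2 / 4 ≤ (n.choose 2 : ℝ) - d * n / 2 := by
    rw [Nat.cast_choose_two]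
    nlinarith
  have hp0 : 0 ≤ p := by
    rw [hp]
    exact div_nonneg m.cast_nonneg (le_trans (by positivity) hden)
  have hpδ : p * n ≤ 2 * δ := by
    rw [hp, div_mul_eq_mul_div, div_le_iff₀ (lt_of_lt_of_le (by positivity) hden), hm0]
    nlinarith
  have hp1 : p ≤ 1 := by
    have hm' : (m : ℝ) ≤ n * Real.sqrt n := by
      refine hm.trans ?_
      rw [Real.sqrt_eq_rpow, ← Real.rpow_one_add' hn0.le (by norm_num)]
      exact Real.rpow_le_rpow_of_exponent_le (by linarith) (by linarith)
    have hs : 4 ≤ Real.sqrt n := Real.le_sqrt_of_sq_le (by linarith)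
    have hss := Real.mul_self_sqrt hn0.le
    rw [hp, div_le_one (lt_of_lt_of_le (by positivity) hden)]
    nlinarith
  have hexp : Real.exp (-d) ≤ ((n : ℝ) ^ 15)⁻¹ := by
    rw [Real.exp_neg]
    refine inv_anti₀ (by positivity) ?_
    rw [← Real.log_le_iff_le_exp (by positivity), Real.log_pow]
    push_cast
    linarith
  have hnexp : n * Real.exp (-d) ≤ 1 := by
    refine (mul_le_mul_of_nonneg_left hexp hn0.le).trans ?_
    rw [← div_eq_mul_inv, div_le_one (by positivity)]
    exact le_self_pow₀ (by linarith) (by norm_num)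
  have hsmall : 3 * Real.exp (-d) ≤ c / n ^ 14 := by
    refine (mul_le_mul_of_nonneg_left hexp (by norm_num)).trans ?_
    rw [div_le_iff₀ hc] at hnc
    rw [← div_eq_mul_inv, div_le_div_iff₀ (by positivity) (by positivity)]
    nlinarith [pow_pos hn0 14]
  set L : ℝ := lam * n / (100 * δ * Real.log n) with hLdef
  set t : ℝ := lam / (2 * Real.log n) * δ with htdef
  have hLδ : δ * L = n * (lam / (100 * Real.log n)) := by
    rw [hLdef]
    field_simp
  have hnorm : δ ^ 2 * L = n * t / 50 := by
    rw [hLdef, htdef]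
    field_simp
    ring
  have hpL : 2 * p * L ≤ 1 := by
    refine le_of_mul_le_mul_right ?_ hn0
    calc 2 * p * L * n = 2 * (p * n) * L := by ring
      _ ≤ 2 * (2 * δ) * L := by gcongr
      _ = n * (4 * (lam / (100 * Real.log n))) := by linear_combination 4 * hLδ
      _ ≤ n * 1 := by
        gcongr
        rw [mul_div_assoc', div_le_one (by positivity)]
        linarith
      _ = 1 * n := mul_comm _ _
  have ht50 : 50 ≤ t := by
    rw [htdef, div_mul_eq_mul_div, le_div_iff₀ (by positivity)]
    linarith
  have htail : ∀ u : ℝ, 0 ≤ u → u ≤ L →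
      n * (2 * p * u) ^ 2 - Real.log 2 * (t * u) ≤ -15 * u := by
    intro u hu0 huL
    have h1 : (p * n) ^ 2 ≤ (2 * δ) ^ 2 := pow_le_pow_left₀ (by positivity) hpδ 2
    have h2 : n * (2 * p * u) ^ 2 * n ≤ (16 / 50 * t * u) * n := by
      calc n * (2 * p * u) ^ 2 * n = 4 * (p * n) ^ 2 * (u * u) := by ring
        _ ≤ 4 * (2 * δ) ^ 2 * (L * u) := by gcongr
        _ = 16 * (δ ^ 2 * L) * u := by ring
        _ = _ := by rw [hnorm]; ring
    have h3 := le_of_mul_le_mul_right h2 hn0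
    have h4 : 0.69 * (t * u) ≤ Real.log 2 * (t * u) :=
      mul_le_mul_of_nonneg_right (by linarith [Real.log_two_gt_d9]) (by positivity)
    have h5 : 50 * u ≤ t * u := mul_le_mul_of_nonneg_right ht50 hu0
    linarith
  have hbad := prEvent_le_of_forall_regular hν hp0 hp1 (fun w => HasBadSet w.1 w.2 d L t)
    fun K hK => sum_weight_hasBadSet_le hK hd1 hnexp hp0 hp1 hpL htail
  have hgood : (fun w : SimpleGraph (Fin n) × SimpleGraph (Fin n) => ∀ U : Set (Fin n),
      (U.ncard : ℝ) ≤ L → (∃ U' : Set (Fin n), (U'.ncard : ℝ) ≤ 4 * U.ncard / d ∧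
        U ⊆ U' ∪ nbhd w.1 U') → (E2count (w.2 \ w.1) U : ℝ) ≤ t * U.ncard) =
      fun w => ¬ HasBadSet w.1 w.2 d L t := by
    funext w
    simp only [HasBadSet, IsCover, not_exists, not_and, not_lt]
  rw [hgood]
  have htot := prEvent_add_prEvent_not ν fun w => HasBadSet w.1 w.2 d L t
  rw [ENNReal.ofReal_sub _ (by positivity), ENNReal.ofReal_one, tsub_le_iff_right, ← htot, add_comm]
  gcongr
  exact hbad.trans (ENNReal.ofReal_le_ofReal hsmall)

end Sandwich
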